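/- Let 1 < p < ∞ and 0 < λ < p − 1, and set K = (λ/(p−1))^{1/p}. Define u* : [0,π_p] → ℝ by u*(x) = sin_p(Kx)/sin_p(K·π_p/2) for x ∈ [0,π_p/2] and u*(x) = u*(π_p − x) for x ∈ [π_p/2,π_p]. Then max_{x∈[0,π_p]} |u*(x)| = u*(π_p/2) = 1 and ∫₀^{π_p} |u*′(x)|^p dx − λ∫₀^{π_p} |u*(x)|^p dx = 2·K^{p−1}·(cot_p(K·π_p/2))^{p−1}; that is, the constant 2·K^{p−1}·(cot_p(K·π_p/2))^{p−1} in the corresponding Sobolev-type inequality is attained and hence sharp. -/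

import Mathlib

/-- `arcsin_p x = ∫₀ˣ (1 - tᵖ)^(-1/p) dt`. -/
noncomputable def arcsinP (p x : ℝ) : ℝ := ∫ t in (0:ℝ)..x, (1 - t ^ p) ^ (-(1 / p))

/-- The generalized π: `π_p = 2 arcsin_p 1`. -/
noncomputable def piP (p : ℝ) : ℝ := 2 * arcsinP p 1

/-- `sin_p` on `[0, π_p/2]`, defined as the inverse of `arcsin_p : [0,1] → [0, π_p/2]`. -/
noncomputable def sinPHalf (p : ℝ) : ℝ → ℝ := Function.invFunOn (arcsinP p) (Set.Icc 0 1)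

/-- `sin_p` on `[0, π_p]`, extended by `sin_p x = sin_p (π_p - x)`. -/
noncomputable def sinP (p x : ℝ) : ℝ :=
  if x ≤ piP p / 2 then sinPHalf p x else sinPHalf p (piP p - x)

/-- `cos_p x = (1 - sin_p x ^ p)^(1/p)` on `[0, π_p/2]`, with minus sign on `[π_p/2, π_p]`. -/
noncomputable def cosP (p x : ℝ) : ℝ :=
  if x ≤ piP p / 2 then (1 - sinP p x ^ p) ^ (1 / p)
  else -((1 - sinP p x ^ p) ^ (1 / p))

/-- `cot_p x = cos_p x / sin_p x`. -/
noncomputable def cotP (p x : ℝ) : ℝ := cosP p x / sinP p x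

/-- The extremal function `u*(x) = sin_p (K x) / sin_p (K π_p / 2)` on `[0, π_p/2]`,
extended by `u*(x) = u*(π_p - x)` on `[π_p/2, π_p]`. -/
noncomputable def uStar (p K x : ℝ) : ℝ :=
  if x ≤ piP p / 2 then sinP p (K * x) / sinP p (K * (piP p / 2))
  else sinP p (K * (piP p - x)) / sinP p (K * (piP p / 2))

open Set MeasureTheory Filter Topology

lemma base_pos {p t : ℝ} (hp : 1 < p) (h0 : 0 ≤ t) (h1 : t < 1) : 0 < 1 - t ^ p := by
  have := Real.rpow_lt_one h0 h1 (by linarith : 0 < p)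
  linarith

lemma integrand_cont {p : ℝ} (hp : 1 < p) :
    ContinuousOn (fun t : ℝ => (1 - t ^ p) ^ (-(1 / p))) (Ico 0 1) := by
  intro t ht
  apply ContinuousAt.continuousWithinAt
  have : ContinuousAt (fun t : ℝ => t ^ p) t :=
    Real.continuousAt_rpow_const _ _ (Or.inr (by linarith))
  exact (continuousAt_const.sub this).rpow_const (Or.inl (base_pos hp ht.1 ht.2).ne')

lemma integrand_int {p : ℝ} (hp : 1 < p) :
    IntervalIntegrable (fun t : ℝ => (1 - t ^ p) ^ (-(1 / p))) volume 0 1 := by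
  have hp0 : 0 < p := by linarith
  have h1 : IntervalIntegrable (fun t : ℝ => (1 - t) ^ (-(1 / p))) volume 0 1 := by
    have h : IntervalIntegrable (fun t : ℝ => t ^ (-(1 / p))) volume 0 1 := by
      apply intervalIntegral.intervalIntegrable_rpow'
      have : 1 / p < 1 := by rw [div_lt_one hp0]; exact hp
      linarith
    have := h.comp_sub_left 1
    simpa using this.symm
  rw [intervalIntegrable_iff_integrableOn_Ioo_of_le zero_le_one] at h1 ⊢
  refine Integrable.mono' h1 ?_ ?_
  · exact ((integrand_cont hp).mono Ioo_subset_Ico_self).aestronglyMeasurable measurableSet_Ioo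
  · rw [ae_restrict_iff' measurableSet_Ioo]
    refine Eventually.of_forall fun t ht => ?_
    have hb := base_pos hp ht.1.le ht.2
    rw [Real.norm_of_nonneg (Real.rpow_nonneg hb.le _)]
    apply Real.rpow_le_rpow_of_nonpos
    · linarith [ht.2]
    · have : t ^ p ≤ t ^ (1:ℝ) := Real.rpow_le_rpow_of_exponent_ge ht.1 ht.2.le hp.le
      rw [Real.rpow_one] at this
      linarith
    · have : 0 < 1 / p := by positivity
      linarith

lemma arc_cont {p : ℝ} (hp : 1 < p) : ContinuousOn (arcsinP p) (Icc 0 1) := by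
  have := intervalIntegral.continuousOn_primitive_interval' (integrand_int hp) (a := 0) (by simp)
  rw [uIcc_of_le zero_le_one] at this
  exact this

lemma arc_deriv {p x : ℝ} (hp : 1 < p) (hx : x ∈ Ioo (0:ℝ) 1) :
    HasDerivAt (arcsinP p) ((1 - x ^ p) ^ (-(1 / p))) x := by
  have hc := (integrand_cont hp).mono Ioo_subset_Ico_self
  refine intervalIntegral.integral_hasDerivAt_right ?_ ?_ ?_
  · refine (integrand_int hp).mono_set ?_
    rw [uIcc_of_le zero_le_one, uIcc_of_le hx.1.le]
    exact Icc_subset_Icc le_rfl hx.2.le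
  · exact hc.stronglyMeasurableAtFilter isOpen_Ioo x hx
  · exact hc.continuousAt (Ioo_mem_nhds hx.1 hx.2)

lemma arc_mono {p : ℝ} (hp : 1 < p) : StrictMonoOn (arcsinP p) (Icc 0 1) := by
  refine strictMonoOn_of_deriv_pos (convex_Icc 0 1) (arc_cont hp) fun x hx => ?_
  rw [interior_Icc] at hx
  rw [(arc_deriv hp hx).deriv]
  exact Real.rpow_pos_of_pos (base_pos hp hx.1.le hx.2) _

lemma arc_zero (p : ℝ) : arcsinP p 0 = 0 := by simp [arcsinP]

lemma piP_half (p : ℝ) : piP p / 2 = arcsinP p 1 := by simp [piP]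

lemma piP_pos {p : ℝ} (hp : 1 < p) : 0 < piP p / 2 := by
  rw [piP_half, ← arc_zero p]
  exact arc_mono hp (by simp) (by simp) one_pos

lemma arc_surj {p : ℝ} (hp : 1 < p) : SurjOn (arcsinP p) (Icc 0 1) (Icc 0 (piP p / 2)) := by
  have := intermediate_value_Icc zero_le_one (arc_cont hp)
  rwa [arc_zero, ← piP_half] at this

lemma S_mem {p y : ℝ} (hp : 1 < p) (hy : y ∈ Icc 0 (piP p / 2)) : sinPHalf p y ∈ Icc (0:ℝ) 1 :=
  Function.invFunOn_mem (arc_surj hp hy)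

lemma arc_S {p y : ℝ} (hp : 1 < p) (hy : y ∈ Icc 0 (piP p / 2)) : arcsinP p (sinPHalf p y) = y :=
  Function.invFunOn_eq (arc_surj hp hy)

lemma arc_mem {p x : ℝ} (hp : 1 < p) (hx : x ∈ Icc (0:ℝ) 1) : arcsinP p x ∈ Icc 0 (piP p / 2) := by
  constructor
  · rw [← arc_zero p]; exact (arc_mono hp).monotoneOn (by simp) hx hx.1
  · rw [piP_half p]; exact (arc_mono hp).monotoneOn hx (by simp) hx.2

lemma S_arc {p x : ℝ} (hp : 1 < p) (hx : x ∈ Icc (0:ℝ) 1) : sinPHalf p (arcsinP p x) = x :=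
  (arc_mono hp).injOn (S_mem hp (arc_mem hp hx)) hx (arc_S hp (arc_mem hp hx))

lemma S_mono {p : ℝ} (hp : 1 < p) : StrictMonoOn (sinPHalf p) (Icc 0 (piP p / 2)) := by
  intro x hx y hy hxy
  rw [← (arc_mono hp).lt_iff_lt (S_mem hp hx) (S_mem hp hy), arc_S hp hx, arc_S hp hy]
  exact hxy

lemma S_image {p : ℝ} (hp : 1 < p) : sinPHalf p '' Icc 0 (piP p / 2) = Icc 0 1 := by
  apply Subset.antisymm
  · rintro _ ⟨y, hy, rfl⟩; exact S_mem hp hy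
  · intro x hx; exact ⟨_, arc_mem hp hx, S_arc hp hx⟩

lemma S_zero {p : ℝ} (hp : 1 < p) : sinPHalf p 0 = 0 := by
  have := S_arc hp (x := 0) (by simp)
  rwa [arc_zero] at this

lemma S_one {p : ℝ} (hp : 1 < p) : sinPHalf p (piP p / 2) = 1 := by
  rw [piP_half]; exact S_arc hp (by simp)

lemma S_Ioo {p y : ℝ} (hp : 1 < p) (hy : y ∈ Ioo 0 (piP p / 2)) : sinPHalf p y ∈ Ioo (0:ℝ) 1 := by
  have h := piP_pos hp
  constructor
  · have := S_mono hp ⟨le_rfl, h.le⟩ ⟨hy.1.le, hy.2.le⟩ hy.1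
    rwa [S_zero hp] at this
  · have := S_mono hp ⟨hy.1.le, hy.2.le⟩ ⟨h.le, le_rfl⟩ hy.2
    rwa [S_one hp] at this

lemma S_contAt {p y : ℝ} (hp : 1 < p) (hy : y ∈ Ioo 0 (piP p / 2)) :
    ContinuousAt (sinPHalf p) y := by
  apply (S_mono hp).continuousAt_of_image_mem_nhds (Icc_mem_nhds hy.1 hy.2)
  rw [S_image hp]
  exact Icc_mem_nhds (S_Ioo hp hy).1 (S_Ioo hp hy).2

lemma S_cont {p : ℝ} (hp : 1 < p) : ContinuousOn (sinPHalf p) (Ico 0 (piP p / 2)) := by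
  intro y hy
  rcases hy.1.eq_or_lt with h | h
  · subst h
    have : ContinuousWithinAt (sinPHalf p) (Ici 0) 0 := by
      apply (S_mono hp).continuousWithinAt_right_of_image_mem_nhdsWithin
        (Icc_mem_nhdsGE (piP_pos hp))
      rw [S_image hp, S_zero hp]
      exact Icc_mem_nhdsGE one_pos
    exact this.mono (fun x hx => hx.1)
  · exact (S_contAt hp ⟨h, hy.2⟩).continuousWithinAt

lemma S_deriv {p y : ℝ} (hp : 1 < p) (hy : y ∈ Ioo 0 (piP p / 2)) :
    HasDerivAt (sinPHalf p) ((1 - sinPHalf p y ^ p) ^ (1 / p)) y := by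
  have hS := S_Ioo hp hy
  have hb := base_pos hp hS.1.le hS.2
  have := HasDerivAt.of_local_left_inverse (S_contAt hp hy) (arc_deriv hp hS)
    (Real.rpow_pos_of_pos hb _).ne' (by
      filter_upwards [Icc_mem_nhds hy.1 hy.2] with z hz using arc_S hp hz)
  rwa [Real.rpow_neg hb.le, inv_inv] at this

lemma F_deriv {p y : ℝ} (hp : 1 < p) (hy : y ∈ Ioo 0 (piP p / 2)) :
    HasDerivAt (fun y => sinPHalf p y * (1 - sinPHalf p y ^ p) ^ ((p - 1) / p))
      (1 - p * sinPHalf p y ^ p) y := by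
  have hS := S_Ioo hp hy
  have hb := base_pos hp hS.1.le hS.2
  have hp0 : p ≠ 0 := by linarith
  have hd := S_deriv hp hy
  have h1 := ((hd.rpow_const (p := p) (Or.inl hS.1.ne')).const_sub 1).rpow_const
    (p := (p - 1) / p) (Or.inl hb.ne')
  have h2 := hd.mul h1
  refine h2.congr_deriv ?_
  generalize sinPHalf p y = s at *
  set b := 1 - s ^ p with hbd
  have e1 : b ^ (1 / p) * b ^ ((p - 1) / p) = b := by
    rw [← Real.rpow_add hb, ← add_div]; simp [hp0]
  have e2 : b ^ (1 / p) * b ^ ((p - 1) / p - 1) = 1 := by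
    rw [← Real.rpow_add hb]
    have : 1 / p + ((p - 1) / p - 1) = 0 := by field_simp; ring
    rw [this, Real.rpow_zero]
  have e3 : s * s ^ (p - 1) = s ^ p := by
    rw [Real.rpow_sub_one hS.1.ne']
    field_simp [hS.1.ne']
  have : b ^ (1 / p) * b ^ ((p - 1) / p) + s * (-(b ^ (1 / p) * p * s ^ (p - 1)) * ((p - 1) / p) * b ^ ((p - 1) / p - 1))
     = b ^ (1 / p) * b ^ ((p - 1) / p) - (p * ((p - 1) / p)) * (s * s ^ (p - 1)) * (b ^ (1 / p) * b ^ ((p - 1) / p - 1)) := by ring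
  rw [this, e1, e2, e3, mul_div_cancel₀ _ hp0, hbd]
  ring

lemma F_int {p a : ℝ} (hp : 1 < p) (ha : a ∈ Ioo 0 (piP p / 2)) :
    ∫ y in (0:ℝ)..a, (1 - p * sinPHalf p y ^ p)
      = sinPHalf p a * (1 - sinPHalf p a ^ p) ^ ((p - 1) / p) := by
  have hc : ContinuousOn (sinPHalf p) (Icc 0 a) :=
    (S_cont hp).mono fun x hx => ⟨hx.1, hx.2.trans_lt ha.2⟩
  have hcp : ContinuousOn (fun y => sinPHalf p y ^ p) (Icc 0 a) :=
    hc.rpow_const fun x hx => Or.inr (by linarith)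
  rw [intervalIntegral.integral_eq_sub_of_hasDerivAt_of_le
    (f := fun y => sinPHalf p y * (1 - sinPHalf p y ^ p) ^ ((p - 1) / p)) ha.1.le ?_
    (fun x hx => F_deriv hp ⟨hx.1, hx.2.trans ha.2⟩) ?_]
  · simp [S_zero hp]
  · refine hc.mul ((continuousOn_const.sub hcp).rpow_const fun x hx => Or.inr ?_)
    exact div_nonneg (by linarith) (by linarith)
  · apply ContinuousOn.intervalIntegrable
    rw [uIcc_of_le ha.1.le]
    exact continuousOn_const.sub (continuousOn_const.mul hcp)

lemma int_symm {f : ℝ → ℝ} {c : ℝ} (hf : ∀ x, f (2 * c - x) = f x)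
    (hi : IntervalIntegrable f volume 0 c) :
    ∫ x in (0:ℝ)..2 * c, f x = 2 * ∫ x in (0:ℝ)..c, f x := by
  have h1 := intervalIntegral.integral_comp_sub_left (a := 0) (b := c) f (2 * c)
  have h2 := hi.comp_sub_left (2 * c)
  simp only [hf, sub_zero] at h1 h2
  have e : 2 * c - c = c := by ring
  rw [e] at h1 h2
  rw [← intervalIntegral.integral_add_adjacent_intervals hi h2.symm, ← h1]
  ring


lemma uStar_symm (p K x : ℝ) : uStar p K (2 * (piP p / 2) - x) = uStar p K x := by
  have e : piP p - (2 * (piP p / 2) - x) = x := by ring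
  have e' : 2 * (piP p / 2) - x = piP p - x := by ring
  unfold uStar
  rw [e, e']
  rcases lt_trichotomy x (piP p / 2) with h | h | h
  · rw [if_neg (by linarith), if_pos h.le]
  · rw [if_pos (by linarith), if_pos h.le, h]
    congr 3; ring
  · rw [if_pos (by linarith), if_neg (by linarith)]

/-- For `0 < λ < p - 1` and `K = (λ/(p-1))^(1/p)`, the function `u*` satisfies
`max_{[0,π_p]} |u*| = u*(π_p/2) = 1` and
`∫ |u*'|^p - λ ∫ |u*|^p = 2 K^(p-1) (cot_p (K π_p/2))^(p-1)`, so the constant in the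
corresponding Sobolev-type inequality is attained. -/
theorem sobolev_const_attained (p lam K : ℝ) (hp : 1 < p)
    (hlam0 : 0 < lam) (hlam1 : lam < p - 1)
    (hK : K = (lam / (p - 1)) ^ (1 / p)) :
    IsGreatest ((fun x => |uStar p K x|) '' Set.Icc 0 (piP p)) (uStar p K (piP p / 2)) ∧
    uStar p K (piP p / 2) = 1 ∧
    (∫ x in (0:ℝ)..piP p, |deriv (uStar p K) x| ^ p) -
        lam * ∫ x in (0:ℝ)..piP p, |uStar p K x| ^ p =
      2 * K ^ (p - 1) * (cotP p (K * piP p / 2)) ^ (p - 1) := by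
  have hp0 : 0 < p := by linarith
  have hp1 : 0 < p - 1 := by linarith
  have hq : 0 < lam / (p - 1) := div_pos hlam0 hp1
  have hK0 : 0 < K := by rw [hK]; exact Real.rpow_pos_of_pos hq _
  have hK1 : K < 1 := by
    rw [hK]; exact Real.rpow_lt_one hq.le ((div_lt_one hp1).2 hlam1) (by positivity)
  have hKp : K ^ p * (p - 1) = lam := by
    rw [hK, ← Real.rpow_mul hq.le, one_div_mul_cancel hp0.ne', Real.rpow_one]
    field_simp
  clear hK
  have hh := piP_pos hp
  have hsym := uStar_symm p K
  obtain ⟨h, hhd⟩ : ∃ h, h = piP p / 2 := ⟨_, rfl⟩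
  have hpi : piP p = 2 * h := by rw [hhd]; ring
  rw [← hhd] at hh hsym
  have hKh : ∀ x ∈ Icc 0 h, K * x ∈ Ico 0 h := fun x hx =>
    ⟨mul_nonneg hK0.le hx.1, by nlinarith [hx.1, hx.2]⟩
  have hKh' : ∀ x ∈ Ioo 0 h, K * x ∈ Ioo 0 h := fun x hx =>
    ⟨mul_pos hK0 hx.1, by nlinarith [hx.1, hx.2]⟩
  have ha : K * h ∈ Ioo 0 h := ⟨mul_pos hK0 hh, by nlinarith⟩
  have ha' : K * h ∈ Ioo 0 (piP p / 2) := by rw [← hhd]; exact ha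
  have hs := S_Ioo hp ha'
  have hsin : ∀ y ≤ h, sinP p y = sinPHalf p y := fun y hy => by
    unfold sinP; rw [if_pos (by rwa [← hhd])]
  obtain ⟨s, hsd⟩ : ∃ s, s = sinPHalf p (K * h) := ⟨_, rfl⟩
  rw [← hsd] at hs
  have hu : ∀ x ≤ h, uStar p K x = sinPHalf p (K * x) / s := fun x hx => by
    have : K * x ≤ h := by
      by_cases h0 : 0 ≤ x
      · nlinarith
      · nlinarith
    unfold uStar
    rw [← hhd, if_pos hx, hsin _ this, hsin _ ha.2.le, hsd]
  have hu1 : uStar p K h = 1 := by rw [hu h le_rfl, ← hsd, div_self hs.1.ne']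
  have hub : ∀ x ∈ Icc 0 h, 0 ≤ uStar p K x ∧ uStar p K x ≤ 1 := fun x hx => by
    have hm := hKh x hx
    rw [hu x hx.2]
    have hm' : K * x ∈ Icc 0 (piP p / 2) := hhd ▸ ⟨hm.1, hm.2.le⟩
    refine ⟨div_nonneg (S_mem hp hm').1 hs.1.le, (div_le_one hs.1).2 ?_⟩
    rw [hsd]
    exact (S_mono hp).monotoneOn hm' ⟨ha'.1.le, ha'.2.le⟩
      (mul_le_mul_of_nonneg_left hx.2 hK0.le)
  rw [← hhd]
  refine ⟨⟨⟨h, ⟨hh.le, by linarith⟩, by simp [hu1]⟩, ?_⟩, hu1, ?_⟩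
  · rintro _ ⟨x, hx, rfl⟩
    rw [hu1]
    rcases le_total x h with hxh | hxh
    · have := hub x ⟨hx.1, hxh⟩
      simpa only [abs_of_nonneg this.1] using this.2
    · have := hub (2 * h - x) ⟨by linarith [hx.2], by linarith⟩
      rw [hsym] at this
      simpa only [abs_of_nonneg this.1] using this.2
  have hdsym : ∀ x, deriv (uStar p K) (2 * h - x) = - deriv (uStar p K) x := fun x => by
    have h1 := deriv_comp_const_sub (f := uStar p K) (a := 2 * h) (x := x)
    have h2 : (fun x => uStar p K (2 * h - x)) = uStar p K := funext hsym
    rw [h2] at h1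
    rw [h1, neg_neg]
  have hcK : ContinuousOn (fun x => sinPHalf p (K * x)) (Icc 0 h) := by
    refine (S_cont hp).comp (by fun_prop) ?_
    rw [← hhd]; exact hKh
  have hcKp : ContinuousOn (fun x => sinPHalf p (K * x) ^ p) (Icc 0 h) :=
    hcK.rpow_const fun x hx => Or.inr hp0.le
  have hud : EqOn (fun x => |uStar p K x| ^ p) (fun x => sinPHalf p (K * x) ^ p / s ^ p)
      (Icc 0 h) := fun x hx => by
    have hm := hKh x hx
    have hm' : K * x ∈ Icc 0 (piP p / 2) := hhd ▸ ⟨hm.1, hm.2.le⟩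
    simp only
    rw [abs_of_nonneg (hub x hx).1, hu x hx.2, Real.div_rpow (S_mem hp hm').1 hs.1.le]
  have hdd : EqOn (fun x => |deriv (uStar p K) x| ^ p)
      (fun x => K ^ p * (1 - sinPHalf p (K * x) ^ p) / s ^ p) (Ioo 0 h) := fun x hx => by
    have hm : K * x ∈ Ioo 0 (piP p / 2) := hhd ▸ hKh' x hx
    have hS := S_Ioo hp hm
    have hb := base_pos hp hS.1.le hS.2
    have hd : HasDerivAt (uStar p K) ((1 - sinPHalf p (K * x) ^ p) ^ (1 / p) * K / s) x := by
      have h1 : HasDerivAt (fun x => K * x) K x := by simpa using (hasDerivAt_id x).const_mul K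
      have h2 := ((S_deriv hp hm).comp x h1).div_const s
      refine h2.congr_of_eventuallyEq ?_
      filter_upwards [Iio_mem_nhds hx.2] with z hz using hu z (le_of_lt hz)
    have hr := Real.rpow_nonneg hb.le (1 / p)
    simp only
    rw [hd.deriv, abs_of_nonneg (div_nonneg (mul_nonneg hr hK0.le) hs.1.le),
      Real.div_rpow (mul_nonneg hr hK0.le) hs.1.le, Real.mul_rpow hr hK0.le,
      ← Real.rpow_mul hb.le, one_div_mul_cancel hp0.ne', Real.rpow_one, mul_comm]
  have hi1' : IntervalIntegrable (fun x => sinPHalf p (K * x) ^ p / s ^ p) volume 0 h := by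
    apply ContinuousOn.intervalIntegrable
    rw [uIcc_of_le hh.le]; exact hcKp.div_const _
  have hi2' : IntervalIntegrable (fun x => K ^ p * (1 - sinPHalf p (K * x) ^ p) / s ^ p)
      volume 0 h := by
    apply ContinuousOn.intervalIntegrable
    rw [uIcc_of_le hh.le]
    exact (continuousOn_const.mul (continuousOn_const.sub hcKp)).div_const _
  have hi1 : IntervalIntegrable (fun x => |uStar p K x| ^ p) volume 0 h := by
    rw [intervalIntegrable_iff_integrableOn_Ioo_of_le hh.le] at hi1' ⊢
    exact hi1'.congr_fun (hud.symm.mono Ioo_subset_Icc_self) measurableSet_Ioo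
  have hi2 : IntervalIntegrable (fun x => |deriv (uStar p K) x| ^ p) volume 0 h := by
    rw [intervalIntegrable_iff_integrableOn_Ioo_of_le hh.le] at hi2' ⊢
    exact hi2'.congr_fun hdd.symm measurableSet_Ioo
  have I1 := int_symm (f := fun x => |uStar p K x| ^ p) (c := h)
    (fun x => by simp only [hsym]) hi1
  have I2 := int_symm (f := fun x => |deriv (uStar p K) x| ^ p) (c := h)
    (fun x => by simp only [hdsym, abs_neg]) hi2
  rw [hpi, I1, I2, intervalIntegral.integral_congr_Ioo_of_le hh.le hdd,
    intervalIntegral.integral_congr_Ioo_of_le hh.le (hud.mono Ioo_subset_Icc_self)]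
  have hcomb : (∫ x in (0:ℝ)..h, K ^ p * (1 - sinPHalf p (K * x) ^ p) / s ^ p)
      - lam * (∫ x in (0:ℝ)..h, sinPHalf p (K * x) ^ p / s ^ p)
      = K ^ p / s ^ p * (K⁻¹ * (s * (1 - s ^ p) ^ ((p - 1) / p))) := by
    rw [← intervalIntegral.integral_const_mul,
      ← intervalIntegral.integral_sub hi2' (hi1'.const_mul lam)]
    have hF := F_int hp ha'
    rw [← hsd] at hF
    have hsub := intervalIntegral.integral_comp_mul_left (a := 0) (b := h)
      (fun y => 1 - p * sinPHalf p y ^ p) hK0.ne'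
    rw [mul_zero, hF, smul_eq_mul] at hsub
    rw [← hsub, ← intervalIntegral.integral_const_mul]
    congr 1
    ext x
    rw [← hKp]
    ring
  have hcot : cotP p (K * (2 * h) / 2) = (1 - s ^ p) ^ (1 / p) / s := by
    have e : K * (2 * h) / 2 = K * h := by ring
    unfold cotP cosP
    rw [e, hsin _ ha.2.le, ← hhd, if_pos ha.2.le, ← hsd]
  have hb := base_pos hp hs.1.le hs.2
  rw [hcot, Real.div_rpow (Real.rpow_nonneg hb.le _) hs.1.le, ← Real.rpow_mul hb.le]
  have e1 : 1 / p * (p - 1) = (p - 1) / p := by ring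
  rw [e1]
  calc _ = 2 * (K ^ p / s ^ p * (K⁻¹ * (s * (1 - s ^ p) ^ ((p - 1) / p)))) := by
        rw [← hcomb]; ring
    _ = _ := by
        rw [Real.rpow_sub_one hK0.ne', Real.rpow_sub_one hs.1.ne']
        have := (Real.rpow_pos_of_pos hs.1 p).ne'
        have := hs.1.ne'
        field_simp
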